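/- For every choice of real coefficients h¹_a, h²_a (a ∈ {x,y,z}) and J_{a,b} (a,b ∈ {x,y,z}), let H := Σ_a h¹_a (σ_a ⊗ 1) + Σ_a h²_a (1 ⊗ σ_a) + Σ_{a,b} J_{a,b} (σ_a ⊗ σ_b) be the two-qubit Hamiltonian. Then there exist nonnegative reals ν¹_a, ν²_a (a ∈ {x,y,z}) and μ_{a,b} (a,b ∈ {x,y,z}) and a real matrix M indexed by the 36 two-qubit configurations such that: (i) M_{C,C'} ≥ 0 for all C ≠ C'; (ii) Σ_C M_{C,C'} = 0 for every C'; and (iii) for every configuration C, i(H·P_C − P_C·H) + Σ_a ν¹_a 𝒟[σ_a⊗1](P_C) + Σ_a ν²_a 𝒟[1⊗σ_a](P_C) + Σ_{a,b} μ_{a,b} 𝒟[σ_a⊗σ_b](P_C) = Σ_{C'} M_{C,C'} • P_{C'} (real scalars acting on complex 4×4 matrices). -/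

import Mathlib

open Matrix Kronecker Finset
open scoped Classical

noncomputable section

/-- The Pauli matrices σ_x, σ_y, σ_z, indexed by `0, 1, 2 : Fin 3`. -/
def σp : Fin 3 → Matrix (Fin 2) (Fin 2) ℂ :=
  ![!![0, 1; 1, 0], !![0, -Complex.I; Complex.I, 0], !![1, 0; 0, -1]]

/-- The sign values `+1, −1`, indexed by `Fin 2`. -/
def sgn : Fin 2 → ℝ := ![1, -1]

/-- The spin projector `P_{s,α} = (1/2)(1 + s • σ_α)`. -/
def Pspin (s : ℝ) (α : Fin 3) : Matrix (Fin 2) (Fin 2) ℂ :=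
  (2 : ℂ)⁻¹ • (1 + (s : ℂ) • σp α)

/-- A single-qubit classical configuration: a sign and an axis. -/
abbrev Conf1 := Fin 2 × Fin 3

/-- The projector attached to a single-qubit configuration. -/
def Pc (c : Conf1) : Matrix (Fin 2) (Fin 2) ℂ := Pspin (sgn c.1) c.2

/-- A two-qubit classical configuration. -/
abbrev Conf2 := Conf1 × Conf1

/-- The projector attached to a two-qubit configuration (Kronecker product). -/
def Pc2 (C : Conf2) : Matrix (Fin 2 × Fin 2) (Fin 2 × Fin 2) ℂ :=
  Pc C.1 ⊗ₖ Pc C.2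

/-- Dual dissipative channel `𝒟[A](X) = A† X A − (1/2)(A†A X + X A†A)`. -/
def Dcal {n : Type*} [Fintype n] (A X : Matrix n n ℂ) : Matrix n n ℂ :=
  Aᴴ * X * A - (2 : ℂ)⁻¹ • (Aᴴ * A * X + X * (Aᴴ * A))

/-- The dual frame of the single-qubit projectors. -/
def Qc (c : Conf1) : Matrix (Fin 2) (Fin 2) ℂ := Pc c - (3 : ℂ)⁻¹ • 1

/-- The dual frame of the two-qubit projectors. -/
def Qc2 (C : Conf2) : Matrix (Fin 2 × Fin 2) (Fin 2 × Fin 2) ℂ := Qc C.1 ⊗ₖ Qc C.2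

lemma σp_herm (a : Fin 3) : (σp a)ᴴ = σp a := by
  fin_cases a <;> ext i j <;> fin_cases i <;> fin_cases j <;> simp [σp]

lemma σp_sq (a : Fin 3) : σp a * σp a = 1 := by
  fin_cases a <;> ext i j <;> fin_cases i <;> fin_cases j <;> simp [σp]

lemma Pc_herm (c : Conf1) : (Pc c)ᴴ = Pc c := by
  simp [Pc, Pspin, conjTranspose_smul, σp_herm]

lemma Qc_herm (c : Conf1) : (Qc c)ᴴ = Qc c := by
  simp [Qc, conjTranspose_smul, Pc_herm]

lemma Pc2_herm (C : Conf2) : (Pc2 C)ᴴ = Pc2 C := by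
  simp [Pc2, conjTranspose_kronecker, Pc_herm]

lemma Qc2_herm (C : Conf2) : (Qc2 C)ᴴ = Qc2 C := by
  simp [Qc2, conjTranspose_kronecker, Qc_herm]

/-- The frame identity for one qubit. -/
lemma frame1 (i j k l : Fin 2) :
    ∑ c : Conf1, Qc c j i * Pc c k l = if i = k ∧ j = l then 1 else 0 := by
  rw [Fintype.sum_prod_type]
  fin_cases i <;> fin_cases j <;> fin_cases k <;> fin_cases l <;>
    simp [Fin.sum_univ_succ, Qc, Pc, Pspin, sgn, σp] <;> ring_nf <;> simp <;> norm_num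

/-- The frame identity for two qubits. -/
lemma frame2 (i j k l : Fin 2 × Fin 2) :
    ∑ C : Conf2, Qc2 C j i * Pc2 C k l = if i = k ∧ j = l then 1 else 0 := by
  have h : ∑ C : Conf2, Qc2 C j i * Pc2 C k l
      = (∑ c : Conf1, Qc c j.1 i.1 * Pc c k.1 l.1) *
        (∑ c : Conf1, Qc c j.2 i.2 * Pc c k.2 l.2) := by
    rw [Finset.sum_mul_sum, Fintype.sum_prod_type]
    refine Finset.sum_congr rfl fun c _ => Finset.sum_congr rfl fun d _ => ?_
    simp only [Qc2, Pc2, kroneckerMap_apply]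
    ring
  rw [h, frame1, frame1]
  simp only [Prod.ext_iff]
  split_ifs <;> simp <;> tauto

lemma reconstruct (X : Matrix (Fin 2 × Fin 2) (Fin 2 × Fin 2) ℂ) :
    ∑ C : Conf2, (X * Qc2 C).trace • Pc2 C = X := by
  ext k l
  simp only [Matrix.sum_apply, Matrix.smul_apply, smul_eq_mul, Matrix.trace, Matrix.diag_apply,
    Matrix.mul_apply, Finset.sum_mul]
  rw [Finset.sum_comm]
  have h : ∀ i : Fin 2 × Fin 2, ∑ C : Conf2, ∑ j, X i j * Qc2 C j i * Pc2 C k l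
      = ∑ j, X i j * (if i = k ∧ j = l then 1 else 0) := by
    intro i
    rw [Finset.sum_comm]
    refine Finset.sum_congr rfl fun j _ => ?_
    rw [← frame2, Finset.mul_sum]
    exact Finset.sum_congr rfl fun C _ => by ring
  simp only [h, mul_ite, mul_one, mul_zero, ite_and]
  simp

lemma trace_real (X Q : Matrix (Fin 2 × Fin 2) (Fin 2 × Fin 2) ℂ) (hX : Xᴴ = X) (hQ : Qᴴ = Q) :
    (((X * Q).trace.re : ℝ) : ℂ) = (X * Q).trace := by
  rw [← Complex.conj_eq_iff_re]
  have := Matrix.trace_conjTranspose (X * Q)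
  rw [conjTranspose_mul, hX, hQ, Matrix.trace_mul_comm] at this
  exact this.symm

lemma sum_Pc : ∑ c : Conf1, Pc c = (3 : ℂ) • (1 : Matrix (Fin 2) (Fin 2) ℂ) := by
  rw [Fintype.sum_prod_type]
  ext i j
  fin_cases i <;> fin_cases j <;>
    simp [Fin.sum_univ_succ, Pc, Pspin, sgn, σp] <;> ring_nf

lemma sum_Pc2 : ∑ C : Conf2, Pc2 C
    = (9 : ℂ) • (1 : Matrix (Fin 2 × Fin 2) (Fin 2 × Fin 2) ℂ) := by
  have h : ∑ C : Conf2, Pc2 C = (∑ c : Conf1, Pc c) ⊗ₖ (∑ c : Conf1, Pc c) := by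
    ext i j
    simp only [Matrix.sum_apply, kroneckerMap_apply, Finset.sum_mul_sum, Pc2]
    rw [Fintype.sum_prod_type]
  rw [h, sum_Pc, smul_kronecker, kronecker_smul, one_kronecker_one, smul_smul]
  norm_num

lemma twirl_gen (x y z w : ℂ) :
    ∑ a : Fin 3, σp a * !![x, y; z, w] * σp a
      = (2 * (x + w)) • (1 : Matrix (Fin 2) (Fin 2) ℂ) - !![x, y; z, w] := by
  have hI := Complex.I_mul_I
  rw [Fin.sum_univ_three]
  ext i j
  fin_cases i <;> fin_cases j <;> simp [σp] <;> grind

lemma Pc_trace (c : Conf1) : Pc c 0 0 + Pc c 1 1 = 1 := by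
  obtain ⟨s, b⟩ := c
  fin_cases b <;> simp [Pc, Pspin, σp] <;> ring

lemma twirl (c : Conf1) :
    ∑ a : Fin 3, σp a * Pc c * σp a = (2 : ℂ) • (1 : Matrix (Fin 2) (Fin 2) ℂ) - Pc c := by
  have h := twirl_gen (Pc c 0 0) (Pc c 0 1) (Pc c 1 0) (Pc c 1 1)
  rwa [← Matrix.eta_fin_two, Pc_trace, mul_one] at h

lemma Dcal_of (A X : Matrix (Fin 2 × Fin 2) (Fin 2 × Fin 2) ℂ) (h : Aᴴ = A) (h2 : A * A = 1) :
    Dcal A X = A * X * A - X := by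
  rw [Dcal, h, h2, one_mul, mul_one, ← two_smul ℂ X, smul_smul]
  norm_num

lemma noise (C : Conf2) :
    ∑ a : Fin 3, Dcal (σp a ⊗ₖ (1 : Matrix (Fin 2) (Fin 2) ℂ)) (Pc2 C)
      + ∑ a : Fin 3, Dcal ((1 : Matrix (Fin 2) (Fin 2) ℂ) ⊗ₖ σp a) (Pc2 C)
      + ∑ a : Fin 3, ∑ b : Fin 3, Dcal (σp a ⊗ₖ σp b) (Pc2 C)
    = (4 : ℂ) • 1 - (16 : ℂ) • Pc2 C := by
  have e1 : ∀ a, Dcal (σp a ⊗ₖ (1 : Matrix (Fin 2) (Fin 2) ℂ)) (Pc2 C)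
      = (σp a * Pc C.1 * σp a) ⊗ₖ Pc C.2 - Pc2 C := fun a => by
    rw [Dcal_of, Pc2, ← mul_kronecker_mul, ← mul_kronecker_mul, one_mul, mul_one]
    · rw [conjTranspose_kronecker, σp_herm, conjTranspose_one]
    · rw [← mul_kronecker_mul, σp_sq, one_mul, one_kronecker_one]
  have e2 : ∀ a, Dcal ((1 : Matrix (Fin 2) (Fin 2) ℂ) ⊗ₖ σp a) (Pc2 C)
      = Pc C.1 ⊗ₖ (σp a * Pc C.2 * σp a) - Pc2 C := fun a => by
    rw [Dcal_of, Pc2, ← mul_kronecker_mul, ← mul_kronecker_mul, one_mul, mul_one]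
    · rw [conjTranspose_kronecker, σp_herm, conjTranspose_one]
    · rw [← mul_kronecker_mul, σp_sq, one_mul, one_kronecker_one]
  have e3 : ∀ a b, Dcal (σp a ⊗ₖ σp b) (Pc2 C)
      = (σp a * Pc C.1 * σp a) ⊗ₖ (σp b * Pc C.2 * σp b) - Pc2 C := fun a b => by
    rw [Dcal_of, Pc2, ← mul_kronecker_mul, ← mul_kronecker_mul]
    · rw [conjTranspose_kronecker, σp_herm, σp_herm]
    · rw [← mul_kronecker_mul, σp_sq, σp_sq, one_kronecker_one]
  simp only [e1, e2, e3]
  have t1 := twirl C.1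
  have t2 := twirl C.2
  rw [← one_kronecker_one]
  ext i j
  have t1' := congrFun (congrFun t1 i.1) j.1
  have t2' := congrFun (congrFun t2 i.2) j.2
  simp only [Fin.sum_univ_three, Matrix.add_apply, Matrix.sub_apply, Matrix.smul_apply,
    kroneckerMap_apply, Pc2, smul_eq_mul] at t1' t2' ⊢
  generalize (σp 0 * Pc C.1 * σp 0) i.1 j.1 = x0 at *
  generalize (σp 1 * Pc C.1 * σp 1) i.1 j.1 = x1 at *
  generalize (σp 2 * Pc C.1 * σp 2) i.1 j.1 = x2 at *
  generalize (σp 0 * Pc C.2 * σp 0) i.2 j.2 = y0 at *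
  generalize (σp 1 * Pc C.2 * σp 1) i.2 j.2 = y1 at *
  generalize (σp 2 * Pc C.2 * σp 2) i.2 j.2 = y2 at *
  generalize Pc C.1 i.1 j.1 = p at *
  generalize Pc C.2 i.2 j.2 = q at *
  generalize (1 : Matrix (Fin 2) (Fin 2) ℂ) i.1 j.1 = u at *
  generalize (1 : Matrix (Fin 2) (Fin 2) ℂ) i.2 j.2 = v at *
  obtain rfl : x0 = 2 * u - p - x1 - x2 := by linear_combination t1'
  obtain rfl : y0 = 2 * v - q - y1 - y2 := by linear_combination t2'
  ring

/-- **Classical computability of open two-qubit dynamics.**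
For any Hamiltonian built from single-site and pairwise Pauli terms, there exist
nonnegative noise weights and a matrix `M` on the 36 two-qubit configurations with
nonnegative off-diagonal entries and vanishing column sums, decomposing the Lindblad
dual dynamics over the configuration projectors. -/
theorem classical_computability_two_qubit
    (h1 h2 : Fin 3 → ℝ) (J : Fin 3 → Fin 3 → ℝ)
    (H : Matrix (Fin 2 × Fin 2) (Fin 2 × Fin 2) ℂ)
    (hH : H = ∑ a : Fin 3, (h1 a : ℂ) • (σp a ⊗ₖ (1 : Matrix (Fin 2) (Fin 2) ℂ))
        + ∑ a : Fin 3, (h2 a : ℂ) • ((1 : Matrix (Fin 2) (Fin 2) ℂ) ⊗ₖ σp a)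
        + ∑ a : Fin 3, ∑ b : Fin 3, (J a b : ℂ) • (σp a ⊗ₖ σp b)) :
    ∃ (ν1 ν2 : Fin 3 → ℝ) (μ : Fin 3 → Fin 3 → ℝ) (M : Conf2 → Conf2 → ℝ),
      (∀ a, 0 ≤ ν1 a) ∧ (∀ a, 0 ≤ ν2 a) ∧ (∀ a b, 0 ≤ μ a b) ∧
      (∀ C C', C ≠ C' → 0 ≤ M C C') ∧
      (∀ C', ∑ C : Conf2, M C C' = 0) ∧
      (∀ C : Conf2,
        Complex.I • (H * Pc2 C - Pc2 C * H)
          + ∑ a : Fin 3, ν1 a • Dcal (σp a ⊗ₖ (1 : Matrix (Fin 2) (Fin 2) ℂ)) (Pc2 C)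
          + ∑ a : Fin 3, ν2 a • Dcal ((1 : Matrix (Fin 2) (Fin 2) ℂ) ⊗ₖ σp a) (Pc2 C)
          + ∑ a : Fin 3, ∑ b : Fin 3, μ a b • Dcal (σp a ⊗ₖ σp b) (Pc2 C)
        = ∑ C' : Conf2, M C C' • Pc2 C') := by
  have hHh : Hᴴ = H := by
    subst hH
    simp [conjTranspose_sum, conjTranspose_smul, conjTranspose_kronecker, σp_herm]
  set L : Conf2 → Matrix (Fin 2 × Fin 2) (Fin 2 × Fin 2) ℂ :=
    fun C => Complex.I • (H * Pc2 C - Pc2 C * H) with hL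
  have hLh : ∀ C, (L C)ᴴ = L C := by
    intro C
    simp only [hL, conjTranspose_smul, conjTranspose_sub, conjTranspose_mul, hHh, Pc2_herm]
    simp only [RCLike.star_def, Complex.conj_I]
    rw [neg_smul, ← smul_neg, neg_sub]
  have hLs : ∑ C, L C = 0 := by
    simp only [hL]
    rw [← Finset.smul_sum, Finset.sum_sub_distrib, ← Finset.mul_sum, ← Finset.sum_mul, sum_Pc2]
    simp
  set A : Conf2 → Conf2 → ℝ := fun C C' => (L C * Qc2 C').trace.re with hA
  have hAL : ∀ C, ∑ C', A C C' • Pc2 C' = L C := by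
    intro C
    conv_rhs => rw [← reconstruct (L C)]
    refine Finset.sum_congr rfl fun C' _ => ?_
    rw [← trace_real (L C) (Qc2 C') (hLh C) (Qc2_herm C'), Complex.coe_smul]
  have hAs : ∀ C', ∑ C, A C C' = 0 := by
    intro C'
    simp only [hA]
    rw [← Complex.re_sum, ← Matrix.trace_sum, ← Finset.sum_mul, hLs]
    simp
  set K : ℝ := ∑ C, ∑ C', |A C C'| with hK
  have hK0 : 0 ≤ K := Finset.sum_nonneg fun C _ => Finset.sum_nonneg fun C' _ => abs_nonneg _
  have hAK : ∀ C C', -K ≤ A C C' := by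
    intro C C'
    have h1 : |A C C'| ≤ ∑ C', |A C C'| :=
      Finset.single_le_sum (f := fun C' => |A C C'|) (fun _ _ => abs_nonneg _) (Finset.mem_univ C')
    have h2 : ∑ C', |A C C'| ≤ K :=
      Finset.single_le_sum (f := fun C => ∑ C', |A C C'|)
        (fun _ _ => Finset.sum_nonneg fun _ _ => abs_nonneg _) (Finset.mem_univ C)
    linarith [neg_abs_le (A C C')]
  have hr : 0 ≤ 9 / 4 * K := by positivity
  refine ⟨fun _ => 9 / 4 * K, fun _ => 9 / 4 * K, fun _ _ => 9 / 4 * K,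
    fun C C' => A C C' + K - (if C = C' then 36 * K else 0),
    fun _ => hr, fun _ => hr, fun _ _ => hr, ?_, ?_, ?_⟩
  · intro C C' hne
    simp only [hne, if_false]
    linarith [hAK C C']
  · intro C'
    rw [Finset.sum_sub_distrib, Finset.sum_add_distrib, hAs]
    simp
  · intro C
    have hn := noise C
    simp only [← Finset.smul_sum]
    rw [add_assoc, add_assoc, ← smul_add, ← smul_add, ← add_assoc (∑ a : Fin 3, _), hn]
    simp only [sub_smul, add_smul, ite_smul, zero_smul]
    rw [Finset.sum_sub_distrib, Finset.sum_add_distrib, hAL, ← Finset.smul_sum, sum_Pc2]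
    simp only [Finset.sum_ite_eq, Finset.mem_univ, if_true]
    ext i j
    simp only [Matrix.add_apply, Matrix.sub_apply, Matrix.smul_apply, Complex.real_smul,
      smul_eq_mul, hL]
    push_cast
    ring
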